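/- arXiv:1106.5844 — 9 statements merged into one kernel-verified Lean document; each statement's English description precedes it below -/
import Mathlib

section
/- Let θ1, θ2, θ3 > 0 with θ1 + θ2 + θ3 = π and set a_i = cot θ_i. Then the characteristic polynomial of the matrix L₃ satisfies det(L₃ − x·I₃) = −x³ + 2(a1 + a2 + a3)x² − 3x for all real x; in particular the product of the two nonzero eigenvalues of L₃ equals 3. -/
open Real

/-- The pairwise products of the cotangents of the angles of a triangle sum to `1`. -/
theorem cot_mul_cot_add_eq_one {α β γ : ℝ} (hα : sin α ≠ 0) (hβ : sin β ≠ 0) (hγ : sin γ ≠ 0)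
    (hsum : α + β + γ = π) : cot α * cot β + cot β * cot γ + cot γ * cot α = 1 := by
  have h : γ = π - (α + β) := by linarith
  have hs : sin γ = sin α * cos β + cos α * sin β := by rw [h, sin_pi_sub, sin_add]
  have hc : cos γ = sin α * sin β - cos α * cos β := by
    rw [h, cos_pi_sub, cos_add]
    ring
  simp only [cot_eq_cos_div_sin]
  field_simp
  rw [hs, hc]
  ring

theorem charpoly_L3 (θ1 θ2 θ3 : ℝ)
    (h1 : 0 < θ1) (h2 : 0 < θ2) (h3 : 0 < θ3)
    (hsum : θ1 + θ2 + θ3 = Real.pi)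
    (a1 a2 a3 : ℝ) (ha1 : a1 = Real.cot θ1) (ha2 : a2 = Real.cot θ2)
    (ha3 : a3 = Real.cot θ3)
    (L : Matrix (Fin 3) (Fin 3) ℝ)
    (hL : L = !![a1 + a3, -a1, -a3; -a1, a1 + a2, -a2; -a3, -a2, a2 + a3]) :
    (∀ x : ℝ,
      (L - x • (1 : Matrix (Fin 3) (Fin 3) ℝ)).det
        = -x ^ 3 + 2 * (a1 + a2 + a3) * x ^ 2 - 3 * x) ∧
    (∀ l1 l2 : ℝ,
      (∀ x : ℝ, (x • (1 : Matrix (Fin 3) (Fin 3) ℝ) - L).det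
        = x * (x - l1) * (x - l2)) → l1 * l2 = 3) := by
  have key : a1 * a2 + a2 * a3 + a3 * a1 = 1 := by
    rw [ha1, ha2, ha3]
    exact cot_mul_cot_add_eq_one (sin_pos_of_pos_of_lt_pi h1 (by linarith)).ne'
      (sin_pos_of_pos_of_lt_pi h2 (by linarith)).ne'
      (sin_pos_of_pos_of_lt_pi h3 (by linarith)).ne' hsum
  have hdet : ∀ x : ℝ, (L - x • (1 : Matrix (Fin 3) (Fin 3) ℝ)).det
      = -x ^ 3 + 2 * (a1 + a2 + a3) * x ^ 2 - 3 * x := by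
    intro x
    simp [hL, Matrix.det_fin_three]
    linear_combination (-3 * x) * key
  refine ⟨hdet, fun l1 l2 h => ?_⟩
  have hneg : ∀ x : ℝ, x * (x - l1) * (x - l2)
      = x ^ 3 - 2 * (a1 + a2 + a3) * x ^ 2 + 3 * x := by
    intro x
    rw [← h x, ← neg_sub, Matrix.det_neg, hdet x, Fintype.card_fin]
    ring
  linear_combination (hneg 1 - hneg (-1)) / 2
end

section
/- Let θ1, θ2, θ3 > 0 with θ1 + θ2 + θ3 = π, a_i = cot θ_i, and S = a1 + a2 + a3. The largest eigenvalue λ2 of L₃ equals S + √(S² − 3), and λ2 ≥ √3 with equality if and only if θ1 = θ2 = θ3 = π/3. (Among all triangles, an equilateral triangle has the minimal λ2.) -/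
open Real

theorem cot_mul_cot_add_of_add_eq_pi {x y z : ℝ} (hx : sin x ≠ 0) (hy : sin y ≠ 0)
    (hz : sin z ≠ 0) (h : x + y + z = π) :
    cot x * cot y + cot y * cot z + cot z * cot x = 1 := by
  obtain rfl : z = π - (x + y) := by linarith
  rw [sin_pi_sub, sin_add] at hz
  simp only [cot_eq_cos_div_sin, cos_pi_sub, sin_pi_sub, cos_add, sin_add]
  field_simp
  ring

theorem eq_of_cot_eq {x y : ℝ} (hx : x ∈ Set.Ioo 0 π) (hy : y ∈ Set.Ioo 0 π)
    (h : cot x = cot y) : x = y := by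
  have sx := (sin_pos_of_mem_Ioo hx).ne'
  have sy := (sin_pos_of_mem_Ioo hy).ne'
  rw [cot_eq_cos_div_sin, cot_eq_cos_div_sin, div_eq_div_iff sx sy] at h
  have hsin : sin (x - y) = 0 := by rw [sin_sub]; linarith
  have := (sin_eq_zero_iff_of_lt_of_lt (by linarith [hx.1, hy.2])
    (by linarith [hx.2, hy.1])).1 hsin
  linarith

theorem lambda2_L3 (θ1 θ2 θ3 : ℝ)
    (h1 : 0 < θ1) (h2 : 0 < θ2) (h3 : 0 < θ3)
    (hsum : θ1 + θ2 + θ3 = Real.pi)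
    (a1 a2 a3 S : ℝ) (ha1 : a1 = Real.cot θ1) (ha2 : a2 = Real.cot θ2)
    (ha3 : a3 = Real.cot θ3) (hS : S = a1 + a2 + a3)
    (L : Matrix (Fin 3) (Fin 3) ℝ)
    (hL : L = !![a1 + a3, -a1, -a3; -a1, a1 + a2, -a2; -a3, -a2, a2 + a3])
    (l1 l2 : ℝ) (hl1 : 0 ≤ l1) (hl12 : l1 ≤ l2)
    (hchar : ∀ x : ℝ, (x • (1 : Matrix (Fin 3) (Fin 3) ℝ) - L).det
      = x * (x - l1) * (x - l2)) :
    l2 = S + Real.sqrt (S ^ 2 - 3) ∧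
    Real.sqrt 3 ≤ l2 ∧
    (l2 = Real.sqrt 3 ↔ θ1 = Real.pi / 3 ∧ θ2 = Real.pi / 3 ∧ θ3 = Real.pi / 3) := by
  have m1 : θ1 ∈ Set.Ioo 0 π := ⟨h1, by linarith⟩
  have m2 : θ2 ∈ Set.Ioo 0 π := ⟨h2, by linarith⟩
  have m3 : θ3 ∈ Set.Ioo 0 π := ⟨h3, by linarith⟩
  have he : a1 * a2 + a2 * a3 + a3 * a1 = 1 := by
    rw [ha1, ha2, ha3]
    exact cot_mul_cot_add_of_add_eq_pi (sin_pos_of_mem_Ioo m1).ne'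
      (sin_pos_of_mem_Ioo m2).ne' (sin_pos_of_mem_Ioo m3).ne' hsum
  have hpoly : ∀ x : ℝ, x * (x ^ 2 - 2 * S * x + 3) = x * (x - l1) * (x - l2) := by
    intro x
    rw [← hchar x, hL, hS, Matrix.det_fin_three]
    simp
    linear_combination (-3 * x) * he
  have hp := hpoly 1
  have hn := hpoly (-1)
  have hadd : l1 + l2 = 2 * S := by linarith
  have hmul : l1 * l2 = 3 := by linarith
  have hl2 : 0 ≤ l2 := hl1.trans hl12
  have hsq : 3 ≤ l2 ^ 2 := by nlinarith
  have hval : l2 = S + √(S ^ 2 - 3) := by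
    have : S ^ 2 - 3 = (l2 - S) ^ 2 := by linear_combination hmul - l2 * hadd
    rw [this, sqrt_sq (by linarith)]
    ring
  refine ⟨hval, (sqrt_le_left hl2).2 hsq, fun h => ?_, ?_⟩
  · have h3sq : l2 ^ 2 = 3 := by rw [h]; exact sq_sqrt (by norm_num)
    have hpos : l2 ≠ 0 := by rintro rfl; norm_num at h3sq
    have hl : l1 = l2 := mul_right_cancel₀ hpos (by linarith)
    have hS3 : (a1 + a2 + a3) ^ 2 = 3 := by
      rw [← hS, show S = l2 by linarith, h3sq]
    have e12 : a1 = a2 := by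
      nlinarith [sq_nonneg (a1 - a2), sq_nonneg (a2 - a3), sq_nonneg (a3 - a1)]
    have e23 : a2 = a3 := by
      nlinarith [sq_nonneg (a1 - a2), sq_nonneg (a2 - a3), sq_nonneg (a3 - a1)]
    have t12 := eq_of_cot_eq m1 m2 (ha1 ▸ ha2 ▸ e12)
    have t23 := eq_of_cot_eq m2 m3 (ha2 ▸ ha3 ▸ e23)
    exact ⟨by linarith, by linarith, by linarith⟩
  · rintro ⟨t1, t2, t3⟩
    have e12 : a1 = a2 := by rw [ha1, ha2, t1, t2]
    have e23 : a2 = a3 := by rw [ha2, ha3, t2, t3]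
    have hS3 : S ^ 2 = 3 := by
      rw [hS, e12, e23]
      rw [e12, e23] at he
      linarith
    rw [hS3, sub_self, sqrt_zero, add_zero] at hval
    rw [← hS3, ← hval, sqrt_sq hl2]
end

section
/- Let θ1, θ2, θ3 > 0 with θ1 + θ2 + θ3 = π, a_i = cot θ_i, and S = a1 + a2 + a3. The smallest nonzero eigenvalue λ1 of L₃ equals S − √(S² − 3), and λ1 ≤ √3 with equality if and only if θ1 = θ2 = θ3 = π/3. (Among all triangles, an equilateral triangle has the maximal λ1.) -/
open Real

theorem cot_mul_cot_add_eq_one_s3 {x y z : ℝ} (hx : sin x ≠ 0) (hy : sin y ≠ 0) (hz : sin z ≠ 0)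
    (h : x + y + z = π) : cot x * cot y + cot y * cot z + cot x * cot z = 1 := by
  have hzxy : z = π - (x + y) := by linarith
  have hsin : sin z = sin x * cos y + cos x * sin y := by rw [hzxy, sin_pi_sub, sin_add]
  have hcos : cos z = -(cos x * cos y - sin x * sin y) := by rw [hzxy, cos_pi_sub, cos_add]
  simp only [cot_eq_cos_div_sin]
  field_simp
  rw [hsin, hcos]
  ring

theorem injOn_cot_Ioo : Set.InjOn cot (Set.Ioo 0 π) := by
  rintro x ⟨hx0, hxπ⟩ y ⟨hy0, hyπ⟩ h
  have hx := (sin_pos_of_pos_of_lt_pi hx0 hxπ).ne'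
  have hy := (sin_pos_of_pos_of_lt_pi hy0 hyπ).ne'
  rw [cot_eq_cos_div_sin, cot_eq_cos_div_sin, div_eq_div_iff hx hy] at h
  have hsin : sin (x - y) = 0 := by
    rw [sin_sub]
    linarith
  linarith [(sin_eq_zero_iff_of_lt_of_lt (by linarith) (by linarith)).1 hsin]

theorem lambda1_L3 (θ1 θ2 θ3 : ℝ)
    (h1 : 0 < θ1) (h2 : 0 < θ2) (h3 : 0 < θ3)
    (hsum : θ1 + θ2 + θ3 = Real.pi)
    (a1 a2 a3 S : ℝ) (ha1 : a1 = Real.cot θ1) (ha2 : a2 = Real.cot θ2)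
    (ha3 : a3 = Real.cot θ3) (hS : S = a1 + a2 + a3)
    (L : Matrix (Fin 3) (Fin 3) ℝ)
    (hL : L = !![a1 + a3, -a1, -a3; -a1, a1 + a2, -a2; -a3, -a2, a2 + a3])
    (l1 l2 : ℝ) (hl1 : 0 ≤ l1) (hl12 : l1 ≤ l2)
    (hchar : ∀ x : ℝ, (x • (1 : Matrix (Fin 3) (Fin 3) ℝ) - L).det
      = x * (x - l1) * (x - l2)) :
    l1 = S - Real.sqrt (S ^ 2 - 3) ∧
    l1 ≤ Real.sqrt 3 ∧
    (l1 = Real.sqrt 3 ↔ θ1 = Real.pi / 3 ∧ θ2 = Real.pi / 3 ∧ θ3 = Real.pi / 3) := by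
  have hs1 := sin_pos_of_pos_of_lt_pi h1 (by linarith)
  have hs2 := sin_pos_of_pos_of_lt_pi h2 (by linarith)
  have hs3 := sin_pos_of_pos_of_lt_pi h3 (by linarith)
  have he2 : a1 * a2 + a2 * a3 + a1 * a3 = 1 := by
    rw [ha1, ha2, ha3]
    exact cot_mul_cot_add_eq_one_s3 hs1.ne' hs2.ne' hs3.ne' hsum
  have hchar' : ∀ x : ℝ, x * (x ^ 2 - 2 * S * x + 3) = x * (x - l1) * (x - l2) := by
    intro x
    rw [← hchar x, hL, Matrix.det_fin_three, hS]
    simp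
    linear_combination -3 * x * he2
  have hadd : l1 + l2 = 2 * S := by linarith [hchar' 1, hchar' (-1)]
  have hmul : l1 * l2 = 3 := by linarith [hchar' 1, hchar' (-1)]
  have hsq : √(S ^ 2 - 3) = (l2 - l1) / 2 := by
    rw [show S ^ 2 - 3 = ((l2 - l1) / 2) ^ 2 by
      rw [show S = (l1 + l2) / 2 by linarith]; linear_combination hmul]
    exact sqrt_sq (by linarith)
  refine ⟨by rw [hsq]; linarith, le_sqrt_of_sq_le (by nlinarith), ?_, ?_⟩
  · intro hl
    have h_three : l1 * l1 = 3 := by rw [hl]; exact mul_self_sqrt (by norm_num)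
    have hl_eq : l2 = l1 :=
      mul_left_cancel₀ (show l1 ≠ 0 by rintro rfl; simp at h_three) (by rw [hmul, h_three])
    have hS2 : S ^ 2 = 3 := by
      rw [show S = l1 by linarith]; linarith
    have hsum_sq : (a1 - a2) ^ 2 + (a2 - a3) ^ 2 + (a1 - a3) ^ 2 = 0 := by
      rw [hS] at hS2
      linear_combination 2 * hS2 - 6 * he2
    have h12 : a1 = a2 := by
      nlinarith [sq_nonneg (a1 - a2), sq_nonneg (a2 - a3), sq_nonneg (a1 - a3)]
    have h23 : a2 = a3 := by
      nlinarith [sq_nonneg (a1 - a2), sq_nonneg (a2 - a3), sq_nonneg (a1 - a3)]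
    have ht12 : θ1 = θ2 := injOn_cot_Ioo ⟨h1, by linarith⟩ ⟨h2, by linarith⟩ 
      (by rw [← ha1, ← ha2, h12])
    have ht23 : θ2 = θ3 := injOn_cot_Ioo ⟨h2, by linarith⟩ ⟨h3, by linarith⟩ 
      (by rw [← ha2, ← ha3, h23])
    refine ⟨?_, ?_, ?_⟩ <;> linarith
  · rintro ⟨rfl, rfl, rfl⟩
    have h12 : a1 = a2 := by rw [ha1, ha2]
    have h23 : a2 = a3 := by rw [ha2, ha3]
    have hS2 : S ^ 2 - 3 = 0 := by
      subst hS h12 h23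
      linear_combination 3 * he2
    rw [hS2, sqrt_zero] at hsq
    rw [eq_comm, sqrt_eq_iff_mul_self_eq (by norm_num) hl1, ← hmul, show l2 = l1 by linarith]
end

section
/- Let θ1, θ2, θ3, θ4 > 0 be real numbers with θ1 + θ2 + θ3 + θ4 = π. Then cot θ1 + cot θ2 + cot θ3 + cot θ4 ≥ 4, and equality holds if and only if θ1 = θ2 = θ3 = θ4 = π/4. -/
open Real

/-- Strict midpoint convexity of the cotangent, valid as long as the midpoint is acute. -/
theorem two_mul_cot_midpoint_lt {a b : ℝ} (ha : 0 < a) (hb : 0 < b) (hab : a + b < π)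
    (hne : a ≠ b) : 2 * cot ((a + b) / 2) < cot a + cot b := by
  obtain ⟨m, hm⟩ : ∃ m, m = (a + b) / 2 := ⟨_, rfl⟩
  obtain ⟨d, hd⟩ : ∃ d, d = (a - b) / 2 := ⟨_, rfl⟩
  have hsa : 0 < sin a := sin_pos_of_pos_of_lt_pi ha (by linarith)
  have hsb : 0 < sin b := sin_pos_of_pos_of_lt_pi hb (by linarith)
  have hsm : 0 < sin m := sin_pos_of_pos_of_lt_pi (by linarith) (by linarith)
  have hcm : 0 < cos m := cos_pos_of_mem_Ioo ⟨by linarith, by linarith⟩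
  have hsd : sin d ≠ 0 := fun h => hne <| by
    have := (sin_eq_zero_iff_of_lt_of_lt (by linarith) (by linarith)).1 h
    linarith
  have hprod : sin a * sin b = sin m ^ 2 - sin d ^ 2 := by
    rw [show a = m + d by linarith, show b = m - d by linarith, sin_add, sin_sub]
    linear_combination sin m ^ 2 * sin_sq_add_cos_sq d - sin d ^ 2 * sin_sq_add_cos_sq m
  have hsum : cos a * sin b + sin a * cos b = 2 * sin m * cos m := by
    rw [← sin_two_mul, show 2 * m = b + a by linarith, sin_add]
    ring
  rw [← hm, cot_eq_cos_div_sin, cot_eq_cos_div_sin, cot_eq_cos_div_sin,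
    div_add_div _ _ hsa.ne' hsb.ne', hsum, ← mul_div_assoc,
    div_lt_div_iff₀ hsm (mul_pos hsa hsb), hprod]
  nlinarith [mul_pos hcm (pow_pos (abs_pos.2 hsd) 2), sq_abs (sin d)]

theorem two_mul_cot_midpoint_le {a b : ℝ} (ha : 0 < a) (hb : 0 < b) (hab : a + b < π) :
    2 * cot ((a + b) / 2) ≤ cot a + cot b := by
  rcases eq_or_ne a b with rfl | hne
  · rw [add_self_div_two, two_mul]
  · exact (two_mul_cot_midpoint_lt ha hb hab hne).le

theorem cot_pi_div_four : cot (π / 4) = 1 := by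
  rw [← tan_inv_eq_cot, tan_pi_div_four, inv_one]

theorem cot_sum_ge_four (θ1 θ2 θ3 θ4 : ℝ)
    (h1 : 0 < θ1) (h2 : 0 < θ2) (h3 : 0 < θ3) (h4 : 0 < θ4)
    (hsum : θ1 + θ2 + θ3 + θ4 = Real.pi) :
    4 ≤ Real.cot θ1 + Real.cot θ2 + Real.cot θ3 + Real.cot θ4 ∧
    (Real.cot θ1 + Real.cot θ2 + Real.cot θ3 + Real.cot θ4 = 4 ↔
      θ1 = Real.pi / 4 ∧ θ2 = Real.pi / 4 ∧ θ3 = Real.pi / 4 ∧ θ4 = Real.pi / 4) := by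
  have h12 := two_mul_cot_midpoint_le h1 h2 (by linarith)
  have h34 := two_mul_cot_midpoint_le h3 h4 (by linarith)
  have hs : 0 < (θ1 + θ2) / 2 := by linarith
  have ht : 0 < (θ3 + θ4) / 2 := by linarith
  have hst : (θ1 + θ2) / 2 + (θ3 + θ4) / 2 < π := by linarith
  have hmid : cot (((θ1 + θ2) / 2 + (θ3 + θ4) / 2) / 2) = 1 := by
    rw [← cot_pi_div_four, ← hsum]
    ring_nf
  have hm := two_mul_cot_midpoint_le hs ht hst
  rw [hmid] at hm
  refine ⟨by linarith, fun h => ?_, ?_⟩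
  · have e12 : θ1 = θ2 := by
      by_contra hne
      linarith [two_mul_cot_midpoint_lt h1 h2 (by linarith) hne]
    have e34 : θ3 = θ4 := by
      by_contra hne
      linarith [two_mul_cot_midpoint_lt h3 h4 (by linarith) hne]
    have em : (θ1 + θ2) / 2 = (θ3 + θ4) / 2 := by
      by_contra hne
      linarith [two_mul_cot_midpoint_lt hs ht hst hne]
    refine ⟨?_, ?_, ?_, ?_⟩ <;> linarith
  · rintro ⟨rfl, rfl, rfl, rfl⟩
    rw [cot_pi_div_four]
    norm_num
end

section
/- Let θ1, θ2, θ3 > 0 be real numbers with θ1 + θ2 + θ3 < π. Then cot θ1 · cot θ2 + cot θ2 · cot θ3 + cot θ3 · cot θ1 > 1. -/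
open Real

theorem cot_products_gt_one (θ1 θ2 θ3 : ℝ)
    (h1 : 0 < θ1) (h2 : 0 < θ2) (h3 : 0 < θ3)
    (hsum : θ1 + θ2 + θ3 < Real.pi) :
    1 < Real.cot θ1 * Real.cot θ2 + Real.cot θ2 * Real.cot θ3
        + Real.cot θ3 * Real.cot θ1 := by
  have s1 : 0 < sin θ1 := sin_pos_of_pos_of_lt_pi h1 (by linarith)
  have s2 : 0 < sin θ2 := sin_pos_of_pos_of_lt_pi h2 (by linarith)
  have s3 : 0 < sin θ3 := sin_pos_of_pos_of_lt_pi h3 (by linarith)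
  have s : 0 < sin (θ1 + θ2 + θ3) := sin_pos_of_pos_of_lt_pi (by linarith) hsum
  have key : Real.cot θ1 * Real.cot θ2 + Real.cot θ2 * Real.cot θ3
      + Real.cot θ3 * Real.cot θ1 - 1
      = sin (θ1 + θ2 + θ3) / (sin θ1 * sin θ2 * sin θ3) := by
    simp only [Real.cot_eq_cos_div_sin, sin_add, cos_add]
    field_simp
    ring
  have : 0 < sin (θ1 + θ2 + θ3) / (sin θ1 * sin θ2 * sin θ3) := by positivity
  linarith
end

section
/- Let θ1, θ2, θ3, θ4 > 0 with θ1 + θ2 + θ3 + θ4 = π and set a_i = cot θ_i. Then the characteristic polynomial of L₄ satisfies det(x·I₄ − L₄) = x⁴ − 2(a1+a2+a3+a4)x³ + (3(a1a2 + a2a3 + a3a4 + a4a1) + 4(a1a3 + a2a4))x² − 4(a1+a2+a3+a4)x for all real x. -/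
open Real

/-- If the sum of four angles has vanishing sine, and none of the angles does, then the first and
third elementary symmetric functions of their cotangents agree. -/
theorem cot_esymm_three_eq_esymm_one {α β γ δ : ℝ} (hα : sin α ≠ 0) (hβ : sin β ≠ 0)
    (hγ : sin γ ≠ 0) (hδ : sin δ ≠ 0) (h : sin (α + β + γ + δ) = 0) :
    cot α * cot β * cot γ + cot α * cot β * cot δ + cot α * cot γ * cot δ
      + cot β * cot γ * cot δ = cot α + cot β + cot γ + cot δ := by
  simp only [sin_add, cos_add] at h
  simp only [cot_eq_cos_div_sin]
  field_simp
  linear_combination h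

theorem charpoly_L4 (θ1 θ2 θ3 θ4 : ℝ)
    (h1 : 0 < θ1) (h2 : 0 < θ2) (h3 : 0 < θ3) (h4 : 0 < θ4)
    (hsum : θ1 + θ2 + θ3 + θ4 = Real.pi)
    (a1 a2 a3 a4 : ℝ) (ha1 : a1 = Real.cot θ1) (ha2 : a2 = Real.cot θ2)
    (ha3 : a3 = Real.cot θ3) (ha4 : a4 = Real.cot θ4)
    (L : Matrix (Fin 4) (Fin 4) ℝ)
    (hL : L = !![a1 + a4, -a1, 0, -a4;
                 -a1, a1 + a2, -a2, 0;
                 0, -a2, a2 + a3, -a3;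
                 -a4, 0, -a3, a3 + a4]) :
    ∀ x : ℝ,
      (x • (1 : Matrix (Fin 4) (Fin 4) ℝ) - L).det
        = x ^ 4 - 2 * (a1 + a2 + a3 + a4) * x ^ 3
          + (3 * (a1 * a2 + a2 * a3 + a3 * a4 + a4 * a1)
              + 4 * (a1 * a3 + a2 * a4)) * x ^ 2
          - 4 * (a1 + a2 + a3 + a4) * x := by
  have hs {θ : ℝ} (h0 : 0 < θ) (hπ : θ < π) : sin θ ≠ 0 := (sin_pos_of_pos_of_lt_pi h0 hπ).ne'
  have key := cot_esymm_three_eq_esymm_one (hs h1 (by linarith)) (hs h2 (by linarith))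
    (hs h3 (by linarith)) (hs h4 (by linarith)) (by rw [hsum, sin_pi])
  rw [← ha1, ← ha2, ← ha3, ← ha4] at key
  intro x
  subst hL
  simp [Matrix.det_succ_row_zero, Fin.sum_univ_succ, Fin.succAbove, Matrix.one_apply]
  linear_combination (-4 * x) * key
end

section
/- Let θ1, θ2, θ3, θ4 > 0 with θ1 + θ2 + θ3 + θ4 = π and set a_i = cot θ_i. The product of the three nonzero eigenvalues of L₄ satisfies λ1λ2λ3 = 4(a1 + a2 + a3 + a4) ≥ 16, with equality if and only if θ1 = θ2 = θ3 = θ4 = π/4. (Among all cyclic quadrilaterals, a square has the minimal λ1λ2λ3.) -/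
open Real

/-- The characteristic polynomial of the Laplace matrix of a weighted 4-cycle. -/
lemma det_smul_one_sub_cycle_laplacian (a b c d x : ℝ) :
    (x • (1 : Matrix (Fin 4) (Fin 4) ℝ) - !![a + d, -a, 0, -d;
                 -a, a + b, -b, 0;
                 0, -b, b + c, -c;
                 -d, 0, -c, c + d]).det
      = x ^ 4 - 2 * (a + b + c + d) * x ^ 3
        + (3 * (a * b + b * c + c * d + d * a) + 4 * (a * c + b * d)) * x ^ 2
        - 4 * (a * b * c + a * b * d + a * c * d + b * c * d) * x := by
  simp [Matrix.det_succ_row_zero, Fin.sum_univ_succ, Fin.succAbove, Matrix.one_apply,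
    Matrix.submatrix_apply]
  ring

lemma cot_add_cot_sub {m d : ℝ} (hm : sin m ≠ 0) (hx : sin (m + d) ≠ 0) (hy : sin (m - d) ≠ 0) :
    cot (m + d) + cot (m - d) - 2 * cot m
      = 2 * cos m * sin d ^ 2 / (sin m * (sin (m + d) * sin (m - d))) := by
  simp only [cot_eq_cos_div_sin]
  field_simp
  rw [sin_add, sin_sub, cos_add, cos_sub]
  linear_combination (2 * sin d ^ 2 * cos m) * sin_sq_add_cos_sq m

lemma two_mul_cot_half_add_le {x y : ℝ} (hx : 0 < x) (hy : 0 < y) (hxy : x + y < π) :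
    2 * cot ((x + y) / 2) ≤ cot x + cot y ∧ (cot x + cot y = 2 * cot ((x + y) / 2) → x = y) := by
  have sm : 0 < sin ((x + y) / 2) := sin_pos_of_pos_of_lt_pi (by linarith) (by linarith)
  have cm : 0 < cos ((x + y) / 2) := cos_pos_of_mem_Ioo ⟨by linarith, by linarith⟩
  have sx : 0 < sin x := sin_pos_of_pos_of_lt_pi hx (by linarith)
  have sy : 0 < sin y := sin_pos_of_pos_of_lt_pi hy (by linarith)
  have ex : (x + y) / 2 + (x - y) / 2 = x := by ring
  have ey : (x + y) / 2 - (x - y) / 2 = y := by ring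
  have key := cot_add_cot_sub (d := (x - y) / 2) sm.ne' (by rw [ex]; exact sx.ne')
    (by rw [ey]; exact sy.ne')
  rw [ex, ey] at key
  refine ⟨sub_nonneg.mp (key ▸ by positivity), fun h => ?_⟩
  rw [h, sub_self, eq_comm, div_eq_zero_iff, or_iff_left (by positivity)] at key
  have hd : sin ((x - y) / 2) = 0 := by simpa [cm.ne'] using key
  have := (sin_eq_zero_iff_of_lt_of_lt (by linarith) (by linarith)).mp hd
  linarith

/-- If four angles sum to `π`, the first and third elementary symmetric functions of their
cotangents agree. -/
lemma cot_esymm_three_eq_sum {θ1 θ2 θ3 θ4 : ℝ} (h1 : sin θ1 ≠ 0) (h2 : sin θ2 ≠ 0)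
    (h3 : sin θ3 ≠ 0) (h4 : sin θ4 ≠ 0) (hsum : θ1 + θ2 + θ3 + θ4 = π) :
    cot θ1 * cot θ2 * cot θ3 + cot θ1 * cot θ2 * cot θ4 + cot θ1 * cot θ3 * cot θ4
      + cot θ2 * cot θ3 * cot θ4 = cot θ1 + cot θ2 + cot θ3 + cot θ4 := by
  have hs : sin (θ1 + θ2 + θ3 + θ4) = 0 := by rw [hsum, sin_pi]
  simp only [sin_add, cos_add] at hs
  simp only [cot_eq_cos_div_sin]
  field_simp
  linear_combination hs

lemma four_le_sum_cot {θ1 θ2 θ3 θ4 : ℝ} (h1 : 0 < θ1) (h2 : 0 < θ2) (h3 : 0 < θ3) (h4 : 0 < θ4)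
    (hsum : θ1 + θ2 + θ3 + θ4 = π) :
    4 ≤ cot θ1 + cot θ2 + cot θ3 + cot θ4 ∧
      (cot θ1 + cot θ2 + cot θ3 + cot θ4 = 4 ↔
        θ1 = π / 4 ∧ θ2 = π / 4 ∧ θ3 = π / 4 ∧ θ4 = π / 4) := by
  have hπ : cot (π / 4) = 1 := by rw [← tan_inv_eq_cot, tan_pi_div_four, inv_one]
  obtain ⟨le12, eq12⟩ := two_mul_cot_half_add_le h1 h2 (by linarith)
  obtain ⟨le34, eq34⟩ := two_mul_cot_half_add_le h3 h4 (by linarith)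
  obtain ⟨le, eq⟩ := two_mul_cot_half_add_le (x := (θ1 + θ2) / 2) (y := (θ3 + θ4) / 2)
    (by linarith) (by linarith) (by linarith)
  rw [show ((θ1 + θ2) / 2 + (θ3 + θ4) / 2) / 2 = π / 4 by linarith, hπ] at le eq
  refine ⟨by linarith, fun h => ?_, ?_⟩
  · have e12 := eq12 (by linarith)
    have e34 := eq34 (by linarith)
    have e := eq (by linarith)
    refine ⟨?_, ?_, ?_, ?_⟩ <;> linarith
  · rintro ⟨rfl, rfl, rfl, rfl⟩
    rw [hπ]
    norm_num



theorem prod_lambda_L4 (θ1 θ2 θ3 θ4 : ℝ)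
    (h1 : 0 < θ1) (h2 : 0 < θ2) (h3 : 0 < θ3) (h4 : 0 < θ4)
    (hsum : θ1 + θ2 + θ3 + θ4 = Real.pi)
    (a1 a2 a3 a4 : ℝ) (ha1 : a1 = Real.cot θ1) (ha2 : a2 = Real.cot θ2)
    (ha3 : a3 = Real.cot θ3) (ha4 : a4 = Real.cot θ4)
    (L : Matrix (Fin 4) (Fin 4) ℝ)
    (hL : L = !![a1 + a4, -a1, 0, -a4;
                 -a1, a1 + a2, -a2, 0;
                 0, -a2, a2 + a3, -a3;
                 -a4, 0, -a3, a3 + a4])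
    (l1 l2 l3 : ℝ) (hl1 : 0 ≤ l1) (hl12 : l1 ≤ l2) (hl23 : l2 ≤ l3)
    (hchar : ∀ x : ℝ, (x • (1 : Matrix (Fin 4) (Fin 4) ℝ) - L).det
      = x * (x - l1) * (x - l2) * (x - l3)) :
    l1 * l2 * l3 = 4 * (a1 + a2 + a3 + a4) ∧
    16 ≤ l1 * l2 * l3 ∧
    (l1 * l2 * l3 = 16 ↔ θ1 = Real.pi / 4 ∧ θ2 = Real.pi / 4 ∧ θ3 = Real.pi / 4 ∧ θ4 = Real.pi / 4) := by
  have hprod : l1 * l2 * l3 = 4 * (a1 + a2 + a3 + a4) := by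
    simp only [hL, det_smul_one_sub_cycle_laplacian] at hchar
    have hs : ∀ θ : ℝ, 0 < θ → θ < π → sin θ ≠ 0 := fun θ h h' =>
      (sin_pos_of_pos_of_lt_pi h h').ne'
    have e3 := cot_esymm_three_eq_sum (hs θ1 h1 (by linarith)) (hs θ2 h2 (by linarith))
      (hs θ3 h3 (by linarith)) (hs θ4 h4 (by linarith)) hsum
    rw [← ha1, ← ha2, ← ha3, ← ha4] at e3
    linear_combination 4 * e3 + (8 * (hchar 1 - hchar (-1)) - (hchar 2 - hchar (-2))) / 12
  obtain ⟨hle, heq⟩ := four_le_sum_cot h1 h2 h3 h4 hsum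
  rw [← ha1, ← ha2, ← ha3, ← ha4] at hle heq
  refine ⟨hprod, by linarith, ?_⟩
  rw [← heq, hprod]
  constructor <;> intro h <;> linarith
end

section
/- Let θ1, θ2, θ3, θ4 > 0 with θ1 + θ2 + θ3 + θ4 = π and set a_i = cot θ_i. The second elementary symmetric function of the three nonzero eigenvalues of L₄ satisfies λ1λ2 + λ2λ3 + λ3λ1 = 3(a1a2 + a2a3 + a3a4 + a4a1) + 4(a1a3 + a2a4) ≥ 20, with equality if and only if θ1 = θ2 = θ3 = θ4 = π/4. (Among all cyclic quadrilaterals, a square has the minimal λ1λ2 + λ2λ3 + λ3λ1.) -/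
open Real

theorem cot_add_cot {x y : ℝ} (hx : sin x ≠ 0) (hy : sin y ≠ 0) :
    cot x + cot y = sin (x + y) / (sin x * sin y) := by
  rw [cot_eq_cos_div_sin, cot_eq_cos_div_sin, sin_add]
  field_simp
  ring

theorem cot_add_cot_pos {x y : ℝ} (hx : 0 < x) (hy : 0 < y) (hxy : x + y < π) :
    0 < cot x + cot y := by
  have hsx : 0 < sin x := sin_pos_of_pos_of_lt_pi hx (by linarith)
  have hsy : 0 < sin y := sin_pos_of_pos_of_lt_pi hy (by linarith)
  have hs : 0 < sin (x + y) := sin_pos_of_pos_of_lt_pi (by linarith) hxy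
  rw [cot_add_cot hsx.ne' hsy.ne']
  positivity

theorem cot_mul_cot_eq {x y : ℝ} (hx : 0 < x) (hy : 0 < y) (hxy : x + y < π) :
    cot x * cot y = 1 + cot (x + y) * (cot x + cot y) := by
  have hsx : 0 < sin x := sin_pos_of_pos_of_lt_pi hx (by linarith)
  have hsy : 0 < sin y := sin_pos_of_pos_of_lt_pi hy (by linarith)
  have hs : sin (x + y) ≠ 0 := (sin_pos_of_pos_of_lt_pi (by linarith) hxy).ne'
  rw [cot_add_cot hsx.ne' hsy.ne', cot_eq_cos_div_sin (x + y), cot_eq_cos_div_sin,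
    cot_eq_cos_div_sin]
  field_simp
  rw [cos_add]
  ring

theorem cot_pi_sub (x : ℝ) : cot (π - x) = -cot x := by
  rw [cot_eq_cos_div_sin, cot_eq_cos_div_sin, cos_pi_sub, sin_pi_sub, neg_div]

theorem eq_pi_div_four_of_cot_eq_one {x : ℝ} (hx : 0 < x) (hxπ : x < π) (h : cot x = 1) :
    x = π / 4 := by
  have hs : 0 < sin x := sin_pos_of_pos_of_lt_pi hx hxπ
  rw [cot_eq_cos_div_sin, div_eq_one_iff_eq hs.ne'] at h
  have h0 : sin (x - π / 4) = 0 := by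
    rw [sin_sub, h, sin_pi_div_four, cos_pi_div_four, sub_self]
  have := (sin_eq_zero_iff_of_lt_of_lt (by linarith) (by linarith)).1 h0
  linarith

/-- If `a` and `b` have positive sum and `a * b = 1 + c * (a + b)`, then their sum is at least
twice the positive root of `t ^ 2 = 1 + 2 * c * t`. -/
theorem add_sqrt_le_half_add {a b c : ℝ} (hpos : 0 < a + b) (h : a * b = 1 + c * (a + b)) :
    c + √(1 + c ^ 2) ≤ (a + b) / 2 := by
  have hs : √(1 + c ^ 2) ≤ |(a + b) / 2 - c| :=
    Real.sqrt_le_iff.2 ⟨abs_nonneg _, by rw [sq_abs]; nlinarith [sq_nonneg (a - b)]⟩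
  have hlt : |c| < √(1 + c ^ 2) := by
    rw [← Real.sqrt_sq_eq_abs]
    exact Real.sqrt_lt_sqrt (sq_nonneg c) (by linarith)
  rcases le_abs.1 hs with h' | h'
  · linarith
  · linarith [le_abs_self c]

theorem esymm2_bound {a b c d k : ℝ} (hac : 0 < a + c) (hbd : 0 < b + d)
    (h : a * c = 1 + k * (a + c)) (h' : b * d = 1 - k * (b + d)) :
    20 ≤ 3 * (a * b + b * c + c * d + d * a) + 4 * (a * c + b * d) ∧
    (3 * (a * b + b * c + c * d + d * a) + 4 * (a * c + b * d) = 20 →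
      a = 1 ∧ b = 1 ∧ c = 1 ∧ d = 1) := by
  have hx := add_sqrt_le_half_add hac h
  have hy := add_sqrt_le_half_add (c := -k) hbd (by linarith)
  rw [neg_sq] at hy
  have hs : √(1 + k ^ 2) ^ 2 = 1 + k ^ 2 := Real.sq_sqrt (by positivity)
  have hlt : |k| < √(1 + k ^ 2) := by
    rw [← Real.sqrt_sq_eq_abs]
    exact Real.sqrt_lt_sqrt (sq_nonneg k) (by linarith)
  obtain ⟨hk, hk'⟩ := abs_lt.1 hlt
  set s := √(1 + k ^ 2)
  obtain ⟨x, hxe⟩ : ∃ x, x = (a + c) / 2 - (k + s) := ⟨_, rfl⟩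
  obtain ⟨y, hye⟩ : ∃ y, y = (b + d) / 2 - (-k + s) := ⟨_, rfl⟩
  have hx0 : 0 ≤ x := by linarith
  have hy0 : 0 ≤ y := by linarith
  have key : 3 * (a * b + b * c + c * d + d * a) + 4 * (a * c + b * d)
      = 20 + 16 * k ^ 2 + 12 * (x * y) + x * (12 * s - 4 * k) + y * (12 * s + 4 * k) := by
    subst hxe hye
    linear_combination 4 * h + 4 * h' + 12 * hs
  have hxy : 0 ≤ x * y := mul_nonneg hx0 hy0
  have hxs : 0 ≤ x * (12 * s - 4 * k) := mul_nonneg hx0 (by linarith)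
  have hys : 0 ≤ y * (12 * s + 4 * k) := mul_nonneg hy0 (by linarith)
  have hk2 := sq_nonneg k
  refine ⟨by linarith, fun heq => ?_⟩
  have hk0 : k = 0 := pow_eq_zero_iff two_ne_zero |>.1 (by linarith)
  have hx1 : x = 0 := (mul_eq_zero.1 (by linarith : x * (12 * s - 4 * k) = 0)).resolve_right
    (by linarith)
  have hy1 : y = 0 := (mul_eq_zero.1 (by linarith : y * (12 * s + 4 * k) = 0)).resolve_right
    (by linarith)
  have hs1 : s = 1 := by
    rw [hk0] at hs hk
    nlinarith
  subst hk0
  have hsum : a + c = 2 := by linarith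
  have hsum' : b + d = 2 := by linarith
  have ha : a = 1 := by
    obtain rfl : c = 2 - a := by linarith
    nlinarith [sq_nonneg (a - 1)]
  have hb : b = 1 := by
    obtain rfl : d = 2 - b := by linarith
    nlinarith [sq_nonneg (b - 1)]
  exact ⟨ha, hb, by linarith, by linarith⟩

theorem det_smul_one_sub_cyclic_laplacian (a b c d x : ℝ) :
    (x • (1 : Matrix (Fin 4) (Fin 4) ℝ) - !![a + d, -a, 0, -d;
      -a, a + b, -b, 0; 0, -b, b + c, -c; -d, 0, -c, c + d]).det
      = x * (x ^ 3 - 2 * (a + b + c + d) * x ^ 2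
        + (3 * (a * b + b * c + c * d + d * a) + 4 * (a * c + b * d)) * x
        - 4 * (a * b * c + a * b * d + a * c * d + b * c * d)) := by
  have hM : x • (1 : Matrix (Fin 4) (Fin 4) ℝ) - !![a + d, -a, 0, -d;
      -a, a + b, -b, 0; 0, -b, b + c, -c; -d, 0, -c, c + d]
      = !![x - (a + d), a, 0, d; a, x - (a + b), b, 0; 0, b, x - (b + c), c;
        d, 0, c, x - (c + d)] := by
    ext i j
    fin_cases i <;> fin_cases j <;> simp
  rw [hM, Matrix.det_succ_row_zero]
  simp [Fin.sum_univ_succ, Matrix.det_fin_three, Fin.succAbove]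
  ring

theorem esymm2_lambda_L4 (θ1 θ2 θ3 θ4 : ℝ)
    (h1 : 0 < θ1) (h2 : 0 < θ2) (h3 : 0 < θ3) (h4 : 0 < θ4)
    (hsum : θ1 + θ2 + θ3 + θ4 = Real.pi)
    (a1 a2 a3 a4 : ℝ) (ha1 : a1 = Real.cot θ1) (ha2 : a2 = Real.cot θ2)
    (ha3 : a3 = Real.cot θ3) (ha4 : a4 = Real.cot θ4)
    (L : Matrix (Fin 4) (Fin 4) ℝ)
    (hL : L = !![a1 + a4, -a1, 0, -a4;
                 -a1, a1 + a2, -a2, 0;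
                 0, -a2, a2 + a3, -a3;
                 -a4, 0, -a3, a3 + a4])
    (l1 l2 l3 : ℝ) (hl1 : 0 ≤ l1) (hl12 : l1 ≤ l2) (hl23 : l2 ≤ l3)
    (hchar : ∀ x : ℝ, (x • (1 : Matrix (Fin 4) (Fin 4) ℝ) - L).det
      = x * (x - l1) * (x - l2) * (x - l3)) :
    l1 * l2 + l2 * l3 + l3 * l1
      = 3 * (a1 * a2 + a2 * a3 + a3 * a4 + a4 * a1) + 4 * (a1 * a3 + a2 * a4) ∧
    20 ≤ l1 * l2 + l2 * l3 + l3 * l1 ∧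
    (l1 * l2 + l2 * l3 + l3 * l1 = 20 ↔ θ1 = Real.pi / 4 ∧ θ2 = Real.pi / 4 ∧ θ3 = Real.pi / 4 ∧ θ4 = Real.pi / 4) := by
  have he : l1 * l2 + l2 * l3 + l3 * l1
      = 3 * (a1 * a2 + a2 * a3 + a3 * a4 + a4 * a1) + 4 * (a1 * a3 + a2 * a4) := by
    have hp := hchar 1
    have hm := hchar (-1)
    rw [hL, det_smul_one_sub_cyclic_laplacian] at hp hm
    linear_combination -(hp + hm) / 2
  have h13 : θ1 + θ3 < π := by linarith
  have h24 : θ2 + θ4 < π := by linarith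
  have hprod := cot_mul_cot_eq h2 h4 h24
  rw [show θ2 + θ4 = π - (θ1 + θ3) by linarith, cot_pi_sub] at hprod
  obtain ⟨hle, himp⟩ := esymm2_bound (cot_add_cot_pos h1 h3 h13) (cot_add_cot_pos h2 h4 h24)
    (cot_mul_cot_eq h1 h3 h13) (by linarith)
  rw [← ha1, ← ha2, ← ha3, ← ha4] at hle himp
  refine ⟨he, he ▸ hle, fun h => ?_, ?_⟩
  · obtain ⟨e1, e2, e3, e4⟩ := himp (he ▸ h)
    exact ⟨eq_pi_div_four_of_cot_eq_one h1 (by linarith) (ha1 ▸ e1),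
      eq_pi_div_four_of_cot_eq_one h2 (by linarith) (ha2 ▸ e2),
      eq_pi_div_four_of_cot_eq_one h3 (by linarith) (ha3 ▸ e3),
      eq_pi_div_four_of_cot_eq_one h4 (by linarith) (ha4 ▸ e4)⟩
  · rintro ⟨rfl, rfl, rfl, rfl⟩
    rw [he, ha1, ha2, ha3, ha4, cot_pi_div_four]
    norm_num
end

section
/- Let n ≥ 3 and let θ1, …, θn > 0 be real numbers with θ1 + ⋯ + θn = π. Then cot θ1 + ⋯ + cot θn ≥ n·cot(π/n), and equality holds if and only if θ1 = ⋯ = θn = π/n. -/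
open Real

theorem Real.hasDerivAt_cot {x : ℝ} (hx : sin x ≠ 0) :
    HasDerivAt Real.cot (-(1 / sin x ^ 2)) x := by
  have h := (hasDerivAt_cos x).div (hasDerivAt_sin x) hx
  have hcot : Real.cot = cos / sin := funext Real.cot_eq_cos_div_sin
  rw [hcot]
  refine h.congr_deriv ?_
  rw [← neg_div]
  congr 1
  linarith [sin_sq_add_cos_sq x]

theorem Real.strictConvexOn_cot : StrictConvexOn ℝ (Set.Ioo 0 (π / 2)) Real.cot := by
  have hsin : ∀ x ∈ Set.Ioo 0 (π / 2), 0 < sin x := fun x hx =>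
    sin_pos_of_pos_of_lt_pi hx.1 (by linarith [hx.2, pi_pos])
  refine StrictMonoOn.strictConvexOn_of_deriv (convex_Ioo _ _)
    (fun x hx => (Real.hasDerivAt_cot (hsin x hx).ne').continuousAt.continuousWithinAt) ?_
  rw [interior_Ioo]
  intro x hx y hy hxy
  rw [(Real.hasDerivAt_cot (hsin x hx).ne').deriv, (Real.hasDerivAt_cot (hsin y hy).ne').deriv]
  have hlt : sin x < sin y :=
    sin_lt_sin_of_lt_of_le_pi_div_two (by linarith [hx.1, pi_pos]) hy.2.le hxy
  have hpos := hsin x hx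
  exact neg_lt_neg (by gcongr)

/-- The mean inequality for `cot` at two points, which needs only that their mean is acute. -/
theorem Real.two_mul_cot_half_add_lt {a b : ℝ} (ha : 0 < a) (hb : 0 < b) (hab : a ≠ b)
    (hlt : a + b < π) : 2 * Real.cot ((a + b) / 2) < Real.cot a + Real.cot b := by
  obtain ⟨s, hs⟩ : ∃ s, s = (a + b) / 2 := ⟨_, rfl⟩
  obtain ⟨d, hd⟩ : ∃ d, d = (a - b) / 2 := ⟨_, rfl⟩
  obtain rfl : a = s + d := by linarith
  obtain rfl : b = s - d := by linarith
  have hsa := sin_pos_of_pos_of_lt_pi ha (by linarith)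
  have hsb := sin_pos_of_pos_of_lt_pi hb (by linarith)
  have hss := sin_pos_of_pos_of_lt_pi (x := s) (by linarith) (by linarith)
  have hcs : 0 < cos s := cos_pos_of_mem_Ioo ⟨by linarith [pi_pos], by linarith⟩
  have hsd : 0 < sin d ^ 2 := by
    have hd0 : d ≠ 0 := fun h => hab (by rw [h]; ring)
    have : sin d ≠ 0 := fun h =>
      hd0 ((sin_eq_zero_iff_of_lt_of_lt (by linarith) (by linarith)).1 h)
    positivity
  rw [← hs, Real.cot_eq_cos_div_sin, Real.cot_eq_cos_div_sin, Real.cot_eq_cos_div_sin,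
    div_add_div _ _ hsa.ne' hsb.ne', mul_div_assoc', div_lt_div_iff₀ hss (mul_pos hsa hsb),
    ← sub_pos]
  have key : (cos (s + d) * sin (s - d) + sin (s + d) * cos (s - d)) * sin s
      - 2 * cos s * (sin (s + d) * sin (s - d)) = 2 * cos s * sin d ^ 2 := by
    rw [sin_add, sin_sub, cos_add, cos_sub]
    linear_combination 2 * cos s * sin d ^ 2 * sin_sq_add_cos_sq s
  rw [key]
  positivity

theorem cot_sum_ge_n_cot_of_acute {n : ℕ} (hn : 0 < n) {θ : Fin n → ℝ}
    (hθ : ∀ i, θ i ∈ Set.Ioo 0 (π / 2)) (hsum : ∑ i, θ i = π) :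
    (n : ℝ) * Real.cot (π / n) ≤ ∑ i, Real.cot (θ i) ∧
    (∑ i, Real.cot (θ i) = (n : ℝ) * Real.cot (π / n) ↔ ∀ i, θ i = π / n) := by
  have hn0 : (0 : ℝ) < n := by exact_mod_cast hn
  have hw0 : ∀ i ∈ (Finset.univ : Finset (Fin n)), 0 < (fun _ : Fin n => (n : ℝ)⁻¹) i :=
    fun _ _ => inv_pos.2 hn0
  have hw1 : ∑ i : Fin n, (fun _ : Fin n => (n : ℝ)⁻¹) i = 1 := by
    simp [hn0.ne']
  have hle := Real.strictConvexOn_cot.convexOn.map_sum_le (fun i hi => (hw0 i hi).le) hw1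
    (fun i _ => hθ i)
  have hiff := Real.strictConvexOn_cot.map_sum_eq_iff hw0 hw1 (fun i _ => hθ i)
  simp only [smul_eq_mul, ← Finset.mul_sum, hsum, Finset.mem_univ, true_implies] at hle hiff
  rw [inv_mul_eq_div, inv_mul_eq_div] at hle hiff
  refine ⟨by rwa [le_div_iff₀' hn0] at hle, ?_⟩
  rw [← hiff, eq_div_iff hn0.ne', eq_comm, mul_comm]

theorem cot_sum_ge_n_cot (n : ℕ) (hn : 3 ≤ n) (θ : Fin n → ℝ)
    (hθ : ∀ i, 0 < θ i) (hsum : ∑ i, θ i = Real.pi) :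
    (n : ℝ) * Real.cot (Real.pi / n) ≤ ∑ i, Real.cot (θ i) ∧
    (∑ i, Real.cot (θ i) = (n : ℝ) * Real.cot (Real.pi / n) ↔
      ∀ i, θ i = Real.pi / n) := by
  by_cases hacute : ∀ i, θ i < π / 2
  · exact cot_sum_ge_n_cot_of_acute (by omega) (fun i => ⟨hθ i, hacute i⟩) hsum
  push Not at hacute
  obtain ⟨i, hi⟩ := hacute
  have : Nontrivial (Fin n) := Fin.nontrivial_iff_two_le.2 (by omega)
  obtain ⟨j, hji⟩ := exists_ne i
  have hsplit : ∀ f : Fin n → ℝ, ∑ k, f k = f i + f j + ∑ k ∈ {i, j}ᶜ, f k := fun f => by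
    rw [← Finset.sum_pair hji.symm, Finset.sum_add_sum_compl]
  have hrest : ∀ k ∈ ({i, j}ᶜ : Finset (Fin n)), θ k ≤ ∑ k ∈ {i, j}ᶜ, θ k := fun k hk =>
    Finset.single_le_sum (f := θ) (fun l _ => (hθ l).le) hk
  obtain ⟨k, hk⟩ : ({i, j}ᶜ : Finset (Fin n)).Nonempty := by
    rw [← Finset.card_pos, Finset.card_compl, Finset.card_pair hji.symm, Fintype.card_fin]
    omega
  have htotal := hsplit θ
  rw [hsum] at htotal
  have hlt : θ i + θ j < π := by linarith [hθ k, hrest k hk]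
  have hne : θ i ≠ θ j := by linarith
  let ψ : Fin n → ℝ := fun l => if l ∈ ({i, j} : Finset (Fin n)) then (θ i + θ j) / 2 else θ l
  have hψi : ψ i = (θ i + θ j) / 2 := by simp [ψ]
  have hψj : ψ j = (θ i + θ j) / 2 := by simp [ψ]
  have hψ : ∀ l ∈ ({i, j}ᶜ : Finset (Fin n)), ψ l = θ l := fun l hl =>
    if_neg (Finset.mem_compl.1 hl)
  have hψacute : ∀ l, ψ l ∈ Set.Ioo 0 (π / 2) := fun l => by
    by_cases hl : l ∈ ({i, j} : Finset (Fin n))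
    · simp only [ψ, if_pos hl]
      constructor <;> linarith [hθ i, hθ j]
    · have hl' := Finset.mem_compl.2 hl
      rw [hψ l hl']
      exact ⟨hθ l, by linarith [hrest l hl', hθ j]⟩
  have hψsum : ∑ l, ψ l = π := by
    rw [hsplit, hψi, hψj, Finset.sum_congr rfl hψ]
    linarith
  have hmean := (cot_sum_ge_n_cot_of_acute (by omega) hψacute hψsum).1
  rw [hsplit, hψi, hψj,
    Finset.sum_congr rfl fun l hl => congrArg Real.cot (hψ l hl)] at hmean
  have hstrict : (n : ℝ) * Real.cot (π / n) < ∑ l, Real.cot (θ l) := by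
    rw [hsplit]
    linarith [Real.two_mul_cot_half_add_lt (hθ i) (hθ j) hne hlt]
  refine ⟨hstrict.le, fun h => absurd h hstrict.ne', fun h => absurd ?_ hne⟩
  rw [h i, h j]
end
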